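/- arXiv:1710.08971 — 2 statements merged into one kernel-verified Lean document; each statement's English description precedes it below -/
import Mathlib

section
/- Let A be an S-sorted set, J a many-sorted closure operator on A, and n a natural number. Then J is n-ary if, and only if, for every X ⊆ A the following holds: if J(Z) ⊆ X for every Z ∈ Sub_{≤n}(X), then J(X) = X. In other words, J is n-ary if and only if every subset of A that contains the J-closure of each of its subsets with at most n elements is a fixed point of J. -/
universe u v w

namespace ManySorted

variable {S : Type u}

/-- The delta of Kronecker `δ^{t,x}`: the S-sorted set whose `t`-th coordinate is `{x}`
and whose other coordinates are empty. -/
def delta {α : S → Type v} (t : S) (x : α t) : ∀ s, Set (α s) :=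
  fun s => {y | (⟨s, y⟩ : Σ s, α s) = ⟨t, x⟩}

/-- The cardinal of an S-sorted set: the cardinal of its coproduct. -/
def scard {α : S → Type v} (X : ∀ s, Set (α s)) : Cardinal.{max u v} :=
  Cardinal.mk (Σ s, ↥(X s))

/-- The support of an S-sorted set. -/
def supp {α : S → Type v} (X : ∀ s, Set (α s)) : Set S := {s | (X s).Nonempty}

section Closure

variable {α : S → Type v}

/-- `J` is a many-sorted closure operator: extensive, isotone and idempotent. -/
def IsClosureOp (J : (∀ s, Set (α s)) → (∀ s, Set (α s))) : Prop :=
  (∀ X s, X s ⊆ J X s) ∧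
  (∀ X Y, (∀ s, X s ⊆ Y s) → ∀ s, J X s ⊆ J Y s) ∧
  (∀ X, J (J X) = J X)

/-- The operator `J_{≤n}`. -/
def Jle (J : (∀ s, Set (α s)) → (∀ s, Set (α s))) (n : ℕ)
    (X : ∀ s, Set (α s)) : ∀ s, Set (α s) :=
  fun s => ⋃ (Y : ∀ s, Set (α s)) (_ : (∀ t, Y t ⊆ X t) ∧ scard Y ≤ (n : Cardinal)), J Y s

/-- The iterates `J_{≤n}^m`. -/
def JleIter (J : (∀ s, Set (α s)) → (∀ s, Set (α s))) (n : ℕ) :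
    ℕ → (∀ s, Set (α s)) → (∀ s, Set (α s))
  | 0 => fun X => X
  | k + 1 => fun X => Jle J n (JleIter J n k X)

/-- The operator `J_{≤n}^ω`. -/
def Jlomega (J : (∀ s, Set (α s)) → (∀ s, Set (α s))) (n : ℕ)
    (X : ∀ s, Set (α s)) : ∀ s, Set (α s) :=
  fun s => ⋃ m : ℕ, JleIter J n m X s

/-- `J` is an `n`-ary many-sorted closure operator if `J = J_{≤n}^ω`. -/
def IsNary (n : ℕ) (J : (∀ s, Set (α s)) → (∀ s, Set (α s))) : Prop :=
  J = Jlomega J n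

/-- `J` is algebraic. -/
def Algebraic (J : (∀ s, Set (α s)) → (∀ s, Set (α s))) : Prop :=
  ∀ X, J X = fun s =>
    ⋃ (K : ∀ s, Set (α s)) (_ : (∀ t, K t ⊆ X t) ∧ scard K < Cardinal.aleph0), J K s

/-- `J` is uniform. -/
def Uniform (J : (∀ s, Set (α s)) → (∀ s, Set (α s))) : Prop :=
  ∀ X Y, supp X = supp Y → supp (J X) = supp (J Y)

/-- `X` is irredundant (independent) with respect to `J`. -/
def Irredundant (J : (∀ s, Set (α s)) → (∀ s, Set (α s)))
    (X : ∀ s, Set (α s)) : Prop :=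
  ∀ s, ∀ x ∈ X s, x ∉ J (fun t => X t \ delta s x t) s

/-- `X` is a basis (generator) with respect to `J`. -/
def IsBasis (J : (∀ s, Set (α s)) → (∀ s, Set (α s)))
    (X : ∀ s, Set (α s)) : Prop :=
  ∀ s, J X s = Set.univ

/-- `IrB (A, J)`: the set of natural numbers that are the cardinal of an irredundant basis. -/
def IrB (J : (∀ s, Set (α s)) → (∀ s, Set (α s))) : Set ℕ :=
  {n | ∃ X : ∀ s, Set (α s), Irredundant J X ∧ IsBasis J X ∧ scard X = (n : Cardinal)}

end Closure

section Algebra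

variable {α : S → Type v}

/-- `X` is closed under all the operations of the algebra `(A, F)`. -/
def Closed (Sig : List S → S → Type w)
    (F : ∀ w s, Sig w s → ((∀ i : Fin w.length, α (w.get i)) → α s))
    (X : ∀ s, Set (α s)) : Prop :=
  ∀ (w : List S) (s : S) (σ : Sig w s) (a : ∀ i : Fin w.length, α (w.get i)),
    (∀ i, a i ∈ X (w.get i)) → F w s σ a ∈ X s

/-- The subalgebra generating operator `Sg`. -/
def Sg (Sig : List S → S → Type w)
    (F : ∀ w s, Sig w s → ((∀ i : Fin w.length, α (w.get i)) → α s))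
    (X : ∀ s, Set (α s)) : ∀ s, Set (α s) :=
  fun s => ⋂ (C : ∀ s, Set (α s)) (_ : Closed Sig F C ∧ ∀ t, X t ⊆ C t), C s

/-- The one-step operator `E_𝐀`. -/
def Estep (Sig : List S → S → Type w)
    (F : ∀ w s, Sig w s → ((∀ i : Fin w.length, α (w.get i)) → α s))
    (X : ∀ s, Set (α s)) : ∀ s, Set (α s) :=
  fun s => X s ∪ {y | ∃ (w : List S) (σ : Sig w s) (a : ∀ i : Fin w.length, α (w.get i)),
    (∀ i, a i ∈ X (w.get i)) ∧ F w s σ a = y}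

/-- The iterates `E_𝐀^n`. -/
def Eiter (Sig : List S → S → Type w)
    (F : ∀ w s, Sig w s → ((∀ i : Fin w.length, α (w.get i)) → α s)) :
    ℕ → (∀ s, Set (α s)) → (∀ s, Set (α s))
  | 0 => fun X => X
  | k + 1 => fun X => Estep Sig F (Eiter Sig F k X)

/-- `E_𝐀^ω`. -/
def Eomega (Sig : List S → S → Type w)
    (F : ∀ w s, Sig w s → ((∀ i : Fin w.length, α (w.get i)) → α s))
    (X : ∀ s, Set (α s)) : ∀ s, Set (α s) :=
  fun s => ⋃ n : ℕ, Eiter Sig F n X s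

end Algebra

end ManySorted

namespace ManySorted

variable {S : Type u} {α : S → Type v} {J : (∀ s, Set (α s)) → (∀ s, Set (α s))} {n : ℕ}

theorem mem_Jle {X : ∀ s, Set (α s)} {s : S} {x : α s} :
    x ∈ Jle J n X s ↔
      ∃ Y : ∀ s, Set (α s), ((∀ t, Y t ⊆ X t) ∧ scard Y ≤ (n : Cardinal)) ∧ x ∈ J Y s := by
  simp [Jle]

theorem mem_Jlomega {X : ∀ s, Set (α s)} {s : S} {x : α s} :
    x ∈ Jlomega J n X s ↔ ∃ m, x ∈ JleIter J n m X s := by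
  simp [Jlomega]

theorem JleIter_subset {X C : ∀ s, Set (α s)} (hXC : ∀ s, X s ⊆ C s)
    (hC : ∀ Z : ∀ s, Set (α s), (∀ t, Z t ⊆ C t) → scard Z ≤ (n : Cardinal) →
      ∀ s, J Z s ⊆ C s) (m : ℕ) (s : S) : JleIter J n m X s ⊆ C s := by
  induction m generalizing s with
  | zero => exact hXC s
  | succ k ih =>
    intro x hx
    obtain ⟨Y, ⟨hY, hcard⟩, hxY⟩ := mem_Jle.1 hx
    exact hC Y (fun t => (hY t).trans (ih t)) hcard s hxY

theorem scard_delta_le_one (t : S) (x : α t) : scard (delta t x) ≤ 1 := by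
  refine Cardinal.le_one_iff_subsingleton.2 ⟨?_⟩
  rintro ⟨s, y, hy⟩ ⟨s', y', hy'⟩
  cases hy
  cases hy'
  rfl

theorem subset_Jle (hJ : IsClosureOp J) (hn : 1 ≤ n) (X : ∀ s, Set (α s)) (s : S) :
    X s ⊆ Jle J n X s := by
  intro x hx
  refine mem_Jle.2 ⟨delta s x, ⟨?_, (scard_delta_le_one s x).trans (by exact_mod_cast hn)⟩,
    hJ.1 _ s rfl⟩
  rintro t y hy
  cases hy
  exact hx

theorem JleIter_mono (hJ : IsClosureOp J) (hn : 1 ≤ n) (X : ∀ s, Set (α s)) (s : S) :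
    Monotone fun m => JleIter J n m X s :=
  monotone_nat_of_le_succ fun m => subset_Jle hJ hn (JleIter J n m X) s

/-- A subset of `J_{≤n}^ω(X)` with at most `n` elements already lies in a finite iterate. -/
theorem exists_subset_JleIter (hJ : IsClosureOp J) {X Z : ∀ s, Set (α s)}
    (hZ : ∀ t, Z t ⊆ Jlomega J n X t) (hcard : scard Z ≤ (n : Cardinal)) :
    ∃ m, ∀ t, Z t ⊆ JleIter J n m X t := by
  have hfin : Finite (Σ s, ↥(Z s)) :=
    Cardinal.lt_aleph0_iff_finite.1 (hcard.trans_lt Cardinal.natCast_lt_aleph0)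
  rcases Nat.eq_zero_or_pos n with rfl | hn
  · have hempty : IsEmpty (Σ s, ↥(Z s)) := by
      rw [← Cardinal.mk_eq_zero_iff]
      simpa [scard] using hcard
    exact ⟨0, fun t z hz => (hempty.false ⟨t, z, hz⟩).elim⟩
  · choose f hf using fun z : Σ s, ↥(Z s) => mem_Jlomega.1 (hZ z.1 z.2.2)
    obtain ⟨M, hM⟩ := (Set.finite_range f).bddAbove
    exact ⟨M, fun t z hz =>
      JleIter_mono hJ hn X t (hM (Set.mem_range_self ⟨t, z, hz⟩)) (hf ⟨t, z, hz⟩)⟩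

theorem J_subset_Jlomega (hJ : IsClosureOp J) {X Z : ∀ s, Set (α s)}
    (hZ : ∀ t, Z t ⊆ Jlomega J n X t) (hcard : scard Z ≤ (n : Cardinal)) (s : S) :
    J Z s ⊆ Jlomega J n X s := by
  obtain ⟨m, hm⟩ := exists_subset_JleIter hJ hZ hcard
  exact fun x hx => mem_Jlomega.2 ⟨m + 1, mem_Jle.2 ⟨Z, ⟨hm, hcard⟩, hx⟩⟩

theorem Jlomega_subset (hJ : IsClosureOp J) (X : ∀ s, Set (α s)) (s : S) :
    Jlomega J n X s ⊆ J X s := by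
  intro x hx
  obtain ⟨m, hm⟩ := mem_Jlomega.1 hx
  refine JleIter_subset (hJ.1 X) (fun Z hZ _ t => ?_) m s hm
  simpa only [hJ.2.2 X] using hJ.2.1 Z (J X) hZ t

end ManySorted

open ManySorted in
/-- `J` is `n`-ary iff every subset of `A` containing the `J`-closure of each of its
subsets with at most `n` elements is a fixed point of `J`. -/
theorem statement_6 {S : Type u} {α : S → Type v}
    (J : (∀ s, Set (α s)) → (∀ s, Set (α s))) (hJ : IsClosureOp J) (n : ℕ) :
    IsNary n J ↔
      ∀ X : ∀ s, Set (α s),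
        (∀ Z : ∀ s, Set (α s), (∀ t, Z t ⊆ X t) → scard Z ≤ (n : Cardinal) →
          ∀ s, J Z s ⊆ X s) →
        J X = X := by
  constructor
  · intro h X hX
    funext s
    refine (Set.Subset.antisymm (hJ.1 X s) fun x hx => ?_).symm
    rw [h] at hx
    obtain ⟨m, hm⟩ := mem_Jlomega.1 hx
    exact JleIter_subset (fun _ => subset_rfl) hX m s hm
  · intro h
    funext X s
    refine Set.Subset.antisymm ?_ (Jlomega_subset hJ X s)
    have hfix := h (Jlomega J n X) fun Z hZ hcard => J_subset_Jlomega hJ hZ hcard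
    have hX : ∀ t, X t ⊆ Jlomega J n X t := fun t x hx => mem_Jlomega.2 ⟨0, hx⟩
    simpa only [hfix] using hJ.2.1 X (Jlomega J n X) hX s
end

section
/- Let J be an algebraic many-sorted closure operator on an S-sorted set A. Then J = Sg_𝐀 for some S-sorted signature Σ and some Σ-algebra 𝐀 with underlying S-sorted set A if, and only if, J is uniform. -/
universe u v w

namespace ManySorted

/-- The S-sorted set of the entries of a tuple of type `w`. -/
def tupleRange {S : Type u} {α : S → Type v} {w : List S}
    (a : ∀ i : Fin w.length, α (w.get i)) : ∀ s, Set (α s) :=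
  fun s => {y | ∃ i, (⟨s, y⟩ : Σ s, α s) = ⟨w.get i, a i⟩}

theorem mem_tupleRange {S : Type u} {α : S → Type v} {w : List S}
    (a : ∀ i : Fin w.length, α (w.get i)) (i : Fin w.length) :
    a i ∈ tupleRange a (w.get i) :=
  ⟨i, rfl⟩

theorem tupleRange_subset {S : Type u} {α : S → Type v} {w : List S}
    {a : ∀ i : Fin w.length, α (w.get i)} {X : ∀ s, Set (α s)}
    (h : ∀ i, a i ∈ X (w.get i)) (s : S) : tupleRange a s ⊆ X s := by
  rintro y ⟨i, hi⟩
  have key : ∀ p : Σ s, α s, p = ⟨w.get i, a i⟩ → p.2 ∈ X p.1 := by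
    rintro p rfl
    exact h i
  exact key _ hi

theorem supp_tupleRange {S : Type u} {α : S → Type v} {w : List S}
    (a : ∀ i : Fin w.length, α (w.get i)) :
    supp (tupleRange a) = Set.range w.get := by
  ext s
  constructor
  · rintro ⟨y, i, hi⟩
    exact ⟨i, (congrArg Sigma.fst hi).symm⟩
  · rintro ⟨i, rfl⟩
    exact ⟨a i, mem_tupleRange a i⟩

theorem exists_tuple_of_list {S : Type u} {α : S → Type v} (l : List (Σ s, α s)) :
    ∃ (w : List S) (a : ∀ i : Fin w.length, α (w.get i)),
      ∀ p : Σ s, α s, p ∈ l ↔ ∃ i, p = ⟨w.get i, a i⟩ := by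
  induction l with
  | nil => exact ⟨[], fun i => i.elim0, fun p => by simp⟩
  | cons q l ih =>
    obtain ⟨w, a, h⟩ := ih
    refine ⟨q.1 :: w, Fin.cons (α := fun i => α ((q.1 :: w).get i)) q.2 a, fun p => ?_⟩
    rw [List.mem_cons, h]
    exact (Fin.exists_fin_succ (P := fun i => p = ⟨(q.1 :: w).get i,
      Fin.cons (α := fun i => α ((q.1 :: w).get i)) q.2 a i⟩)).symm

theorem exists_tupleRange_eq {S : Type u} {α : S → Type v} {K : ∀ s, Set (α s)}
    (hK : scard K < Cardinal.aleph0) :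
    ∃ (w : List S) (a : ∀ i : Fin w.length, α (w.get i)), tupleRange a = K := by
  have : Finite (Σ s, ↥(K s)) := Cardinal.lt_aleph0_iff_finite.mp hK
  have hfin : {p : Σ s, α s | p.2 ∈ K p.1}.Finite :=
    (Set.finite_range (fun p : Σ s, ↥(K s) => (⟨p.1, p.2.1⟩ : Σ s, α s))).subset
      fun p hp => ⟨⟨p.1, p.2, hp⟩, rfl⟩
  obtain ⟨w, a, h⟩ := exists_tuple_of_list hfin.toFinset.toList
  refine ⟨w, a, funext fun s => Set.ext fun y => (h ⟨s, y⟩).symm.trans ?_⟩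
  simp

section Algebra

variable {S : Type u} {α : S → Type v} (Sig : List S → S → Type w)
  (F : ∀ w s, Sig w s → ((∀ i : Fin w.length, α (w.get i)) → α s))

theorem subset_Sg (X : ∀ s, Set (α s)) (s : S) : X s ⊆ Sg Sig F X s :=
  Set.subset_iInter₂ fun _ hC => hC.2 s

theorem closed_Sg (X : ∀ s, Set (α s)) : Closed Sig F (Sg Sig F X) := by
  intro w s σ a ha
  exact Set.mem_iInter₂.mpr fun C hC =>
    hC.1 w s σ a fun i => Set.mem_iInter₂.mp (ha i) C hC

theorem Sg_subset {X C : ∀ s, Set (α s)} (hC : Closed Sig F C) (hX : ∀ s, X s ⊆ C s)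
    (s : S) : Sg Sig F X s ⊆ C s :=
  Set.iInter₂_subset C ⟨hC, hX⟩

theorem supp_Sg_subset {X Y : ∀ s, Set (α s)} (h : supp X ⊆ supp Y) :
    supp (Sg Sig F X) ⊆ supp (Sg Sig F Y) := by
  rintro s ⟨x, hx⟩
  refine Sg_subset Sig F (C := fun s => {_y | s ∈ supp (Sg Sig F Y)}) ?_ ?_ s hx
  · intro w s σ a ha
    choose b hb using ha
    exact ⟨F w s σ b, closed_Sg Sig F Y w s σ b hb⟩
  · exact fun s x hx => (h ⟨x, hx⟩).mono (subset_Sg Sig F Y s)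

theorem uniform_Sg : Uniform (Sg Sig F) := fun _ _ h =>
  (supp_Sg_subset Sig F h.le).antisymm (supp_Sg_subset Sig F h.ge)

end Algebra

/-- The signature of all operations on `α` that take values in the `J`-closure of
their arguments. -/
def closureSig {S : Type u} {α : S → Type v} (J : (∀ s, Set (α s)) → (∀ s, Set (α s)))
    (w : List S) (s : S) : Type (max u v) :=
  ULift.{u} {f : (∀ i : Fin w.length, α (w.get i)) → α s // ∀ a, f a ∈ J (tupleRange a) s}

theorem Uniform.exists_operation {S : Type u} {α : S → Type v}
    {J : (∀ s, Set (α s)) → (∀ s, Set (α s))} (hJ : Uniform J) {w : List S} {s : S}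
    (a : ∀ i : Fin w.length, α (w.get i)) {y : α s} (hy : y ∈ J (tupleRange a) s) :
    ∃ f : (∀ i : Fin w.length, α (w.get i)) → α s,
      (∀ b, f b ∈ J (tupleRange b) s) ∧ f a = y := by
  classical
  have hne : ∀ b : ∀ i : Fin w.length, α (w.get i), (J (tupleRange b) s).Nonempty := by
    intro b
    have hs : s ∈ supp (J (tupleRange a)) := ⟨y, hy⟩
    rwa [hJ (tupleRange a) (tupleRange b) (by rw [supp_tupleRange, supp_tupleRange])] at hs
  choose g hg using hne
  refine ⟨Function.update g a y, fun b => ?_, Function.update_self ..⟩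
  obtain rfl | hb := eq_or_ne b a
  · rwa [Function.update_self]
  · rw [Function.update_of_ne hb]
    exact hg b

theorem Uniform.eq_Sg_closureSig {S : Type u} {α : S → Type v}
    {J : (∀ s, Set (α s)) → (∀ s, Set (α s))} (hunif : Uniform J) (hJ : IsClosureOp J)
    (halg : Algebraic J) :
    J = Sg (closureSig J) (fun _ _ σ => σ.down.1) := by
  obtain ⟨hext, hmono, hidem⟩ := hJ
  funext X s
  refine Set.Subset.antisymm (fun y hy => ?_) (Sg_subset _ _ ?_ (hext X) s)
  · rw [halg X] at hy
    obtain ⟨K, ⟨hKX, hK⟩, hy⟩ := Set.mem_iUnion₂.mp hy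
    obtain ⟨w, a, rfl⟩ := exists_tupleRange_eq hK
    obtain ⟨f, hf, rfl⟩ := hunif.exists_operation a hy
    exact closed_Sg (closureSig J) _ X w s ⟨f, hf⟩ a fun i =>
      subset_Sg _ _ X _ (hKX _ (mem_tupleRange a i))
  · intro w s σ a ha
    rw [← hidem X]
    exact hmono _ _ (tupleRange_subset ha) s (σ.down.2 a)

end ManySorted

open ManySorted in
/-- For an algebraic many-sorted closure operator `J` on `A`: `J = Sg_𝐀` for some
signature `Σ` and `Σ`-algebra `𝐀` on `A` iff `J` is uniform. -/
theorem statement_14 {S : Type u} {α : S → Type v}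
    (J : (∀ s, Set (α s)) → (∀ s, Set (α s))) (hJ : IsClosureOp J)
    (halg : Algebraic J) :
    (∃ (Sig : List S → S → Type (max u v))
      (F : ∀ w s, Sig w s → ((∀ i : Fin w.length, α (w.get i)) → α s)),
      J = Sg Sig F) ↔ Uniform J := by
  constructor
  · rintro ⟨Sig, F, rfl⟩
    exact uniform_Sg Sig F
  · exact fun h => ⟨closureSig J, _, h.eq_Sg_closureSig hJ halg⟩
end
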